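/- Let Q ⊂ ℝ² be an open set which is symmetric with respect to the x-axis, i.e. (x,y) ∈ Q if and only if (x,−y) ∈ Q. Let Ψ = (Ψ₁, Ψ₂) : Q → ℝ² be differentiable on Q and suppose the squared Frobenius norm of its Jacobian, i.e. the function (x,y) ↦ Σ_{i,j=1}^{2} (∂Ψᵢ/∂xⱼ)(x,y)², is integrable on Q. Define J = (J₁, J₂) : Q → ℝ² by J₁(x,y) = ½(Ψ₁(x,y) + Ψ₁(x,−y)) and J₂(x,y) = ½(Ψ₂(x,y) − Ψ₂(x,−y)). Then ∫_Q Σ_{i,j} (∂Jᵢ/∂xⱼ)² ≤ ∫_Q Σ_{i,j} (∂Ψᵢ/∂xⱼ)², i.e. the Dirichlet energy of the symmetrized field J does not exceed that of Ψ. -/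

import Mathlib

open MeasureTheory

/-- The derivative of a function composed with the reflection in the first coordinate axis. -/
lemma HasFDerivAt.comp_reflection {f : ℝ × ℝ → ℝ} {f' : ℝ × ℝ →L[ℝ] ℝ} {z : ℝ × ℝ}
    (hf : HasFDerivAt f f' (z.1, -z.2)) :
    HasFDerivAt (fun w : ℝ × ℝ => f (w.1, -w.2))
      (f'.comp ((ContinuousLinearMap.fst ℝ ℝ ℝ).prod (-ContinuousLinearMap.snd ℝ ℝ ℝ))) z :=
  hf.comp z (hasFDerivAt_fst.prodMk hasFDerivAt_snd.neg)

/-- The reflection in the first coordinate axis preserves Lebesgue measure. -/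
lemma measurePreserving_reflection :
    MeasurePreserving (fun z : ℝ × ℝ => (z.1, -z.2)) volume volume :=
  (MeasurePreserving.id volume).prod (Measure.measurePreserving_neg volume)

/-- The reflection in the first coordinate axis is a measurable embedding. -/
lemma measurableEmbedding_reflection :
    MeasurableEmbedding (fun z : ℝ × ℝ => (z.1, -z.2)) :=
  ((MeasurableEquiv.refl ℝ).prodCongr (MeasurableEquiv.neg ℝ)).measurableEmbedding

/-- A nonnegative function bounded on a reflection-invariant set by the average of an integrable
function and its reflection has integral at most that of the integrable function. -/
lemma setIntegral_le_of_le_reflection_average {Q : Set (ℝ × ℝ)} (hQ : MeasurableSet Q)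
    (hQsym : ∀ x y : ℝ, (x, y) ∈ Q ↔ (x, -y) ∈ Q) {f g : ℝ × ℝ → ℝ} (hf : ∀ z, 0 ≤ f z)
    (hg : IntegrableOn g Q) (hfg : ∀ z ∈ Q, f z ≤ (g z + g (z.1, -z.2)) / 2) :
    ∫ z in Q, f z ≤ ∫ z in Q, g z := by
  have hpre : (fun z : ℝ × ℝ => (z.1, -z.2)) ⁻¹' Q = Q :=
    Set.ext fun z => (hQsym z.1 z.2).symm
  have hgr : IntegrableOn (fun z => g (z.1, -z.2)) Q := by
    have h := (measurePreserving_reflection.integrableOn_comp_preimage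
      measurableEmbedding_reflection).2 hg
    rwa [hpre] at h
  have heq : ∫ z in Q, g (z.1, -z.2) = ∫ z in Q, g z := by
    have h := measurePreserving_reflection.setIntegral_preimage_emb
      measurableEmbedding_reflection g Q
    rwa [hpre] at h
  calc ∫ z in Q, f z ≤ ∫ z in Q, (g z + g (z.1, -z.2)) / 2 :=
        integral_mono_of_nonneg (Filter.Eventually.of_forall hf) ((hg.add hgr).div_const 2)
          (ae_restrict_of_forall_mem hQ hfg)
    _ = ∫ z in Q, g z := by
        rw [integral_div, integral_add hg hgr, heq, add_self_div_two]

/-- Let `Q ⊂ ℝ²` be open and symmetric with respect to the `x`-axis, and let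
`Ψ = (Ψ₁, Ψ₂)` be differentiable on `Q` with integrable squared Frobenius norm
of its Jacobian. Define `J₁(x,y) = ½(Ψ₁(x,y) + Ψ₁(x,-y))` and
`J₂(x,y) = ½(Ψ₂(x,y) - Ψ₂(x,-y))`. Then the Dirichlet energy of `J` over `Q`
does not exceed that of `Ψ`. -/
theorem symmetrized_field_energy_le (Q : Set (ℝ × ℝ)) (hQ : IsOpen Q)
    (hQsym : ∀ x y : ℝ, (x, y) ∈ Q ↔ (x, -y) ∈ Q)
    (Ψ₁ Ψ₂ : ℝ × ℝ → ℝ)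
    (hΨ₁ : ∀ z ∈ Q, DifferentiableAt ℝ Ψ₁ z)
    (hΨ₂ : ∀ z ∈ Q, DifferentiableAt ℝ Ψ₂ z)
    (hint : IntegrableOn
      (fun z => (fderiv ℝ Ψ₁ z (1, 0)) ^ 2 + (fderiv ℝ Ψ₁ z (0, 1)) ^ 2 +
        (fderiv ℝ Ψ₂ z (1, 0)) ^ 2 + (fderiv ℝ Ψ₂ z (0, 1)) ^ 2) Q)
    (J₁ J₂ : ℝ × ℝ → ℝ)
    (hJ₁ : ∀ z : ℝ × ℝ, J₁ z = (Ψ₁ z + Ψ₁ (z.1, -z.2)) / 2)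
    (hJ₂ : ∀ z : ℝ × ℝ, J₂ z = (Ψ₂ z - Ψ₂ (z.1, -z.2)) / 2) :
    ∫ z in Q, ((fderiv ℝ J₁ z (1, 0)) ^ 2 + (fderiv ℝ J₁ z (0, 1)) ^ 2 +
        (fderiv ℝ J₂ z (1, 0)) ^ 2 + (fderiv ℝ J₂ z (0, 1)) ^ 2) ≤
      ∫ z in Q, ((fderiv ℝ Ψ₁ z (1, 0)) ^ 2 + (fderiv ℝ Ψ₁ z (0, 1)) ^ 2 +
        (fderiv ℝ Ψ₂ z (1, 0)) ^ 2 + (fderiv ℝ Ψ₂ z (0, 1)) ^ 2) := by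
  refine setIntegral_le_of_le_reflection_average hQ.measurableSet hQsym
    (fun z => by positivity) hint fun z hz => ?_
  have hz' : (z.1, -z.2) ∈ Q := (hQsym z.1 z.2).1 hz
  have h₁ := ((hΨ₁ z hz).hasFDerivAt.add
    (hΨ₁ _ hz').hasFDerivAt.comp_reflection).mul_const (2⁻¹ : ℝ)
  have h₂ := ((hΨ₂ z hz).hasFDerivAt.sub
    (hΨ₂ _ hz').hasFDerivAt.comp_reflection).mul_const (2⁻¹ : ℝ)
  have e₁ := (h₁.congr_of_eventuallyEq (Filter.Eventually.of_forall hJ₁)).fderiv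
  have e₂ := (h₂.congr_of_eventuallyEq (Filter.Eventually.of_forall hJ₂)).fderiv
  have hneg : ((0 : ℝ), (-1 : ℝ)) = -(0, 1) := by simp
  rw [e₁, e₂]
  simp only [smul_apply, add_apply, sub_apply, ContinuousLinearMap.comp_apply,
    ContinuousLinearMap.prod_apply, neg_apply, ContinuousLinearMap.coe_fst',
    ContinuousLinearMap.coe_snd', neg_zero, hneg, map_neg, smul_eq_mul]
  generalize fderiv ℝ Ψ₁ z (1, 0) = a, fderiv ℝ Ψ₁ z (0, 1) = b,
    fderiv ℝ Ψ₂ z (1, 0) = c, fderiv ℝ Ψ₂ z (0, 1) = d,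
    fderiv ℝ Ψ₁ (z.1, -z.2) (1, 0) = a', fderiv ℝ Ψ₁ (z.1, -z.2) (0, 1) = b',
    fderiv ℝ Ψ₂ (z.1, -z.2) (1, 0) = c', fderiv ℝ Ψ₂ (z.1, -z.2) (0, 1) = d'
  nlinarith [sq_nonneg (a - a'), sq_nonneg (b + b'), sq_nonneg (c + c'), sq_nonneg (d - d')]
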